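/- arXiv:math/0506302 — 4 statements merged into one kernel-verified Lean document; each statement's English description precedes it below -/
import Mathlib

section
/- For trivial self-adjunctions the second triangular equation is derivable from the remaining equations. Precisely: let S be a category, L : S ⥤ S an endofunctor, φ : L ⋙ L ⟶ 𝟭 S a natural transformation, and γ a family of morphisms γ_A : A ⟶ L.obj (L.obj A), one for each object A (naturality of γ is NOT assumed). Assume for every object A: (φγF) L.map (γ_A) ≫ φ.app (L.obj A) = 𝟙 (L.obj A); (φγJ) γ_A ≫ φ.app A = 𝟙 A; and (γφ) φ.app A ≫ γ_A = 𝟙 (L.obj (L.obj A)). Then for every object A the triangular equation (φγG) holds: γ_{L.obj A} ≫ L.map (φ.app A) = 𝟙 (L.obj A). -/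
open CategoryTheory

/-- For trivial self-adjunctions, the second triangular equation (φγG) is derivable from
the remaining equations: given a natural `φ : L ⋙ L ⟶ 𝟭 S` and a family
`γ_A : A ⟶ LLA` satisfying (φγF) `φ_{LA} ∘ Lγ_A = 𝟙_{LA}`, (φγJ) `φ_A ∘ γ_A = 𝟙_A`,
and (γφ) `γ_A ∘ φ_A = 𝟙_{LLA}`, one has (φγG) `Lφ_A ∘ γ_{LA} = 𝟙_{LA}`. -/
theorem trivial_self_adjunction_second_triangle {S : Type*} [Category S]
    (L : S ⥤ S) (φ : L ⋙ L ⟶ 𝟭 S) (γ : ∀ A : S, A ⟶ L.obj (L.obj A))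
    (hF : ∀ A : S, L.map (γ A) ≫ φ.app (L.obj A) = 𝟙 (L.obj A))
    (hJ : ∀ A : S, γ A ≫ φ.app A = 𝟙 A)
    (hT : ∀ A : S, φ.app A ≫ γ A = 𝟙 (L.obj (L.obj A))) :
    ∀ A : S, γ (L.obj A) ≫ L.map (φ.app A) = 𝟙 (L.obj A) := by
  intro A
  have map_app_eq : L.map (φ.app A) = φ.app (L.obj A) := by
    calc L.map (φ.app A)
        = L.map (φ.app A) ≫ L.map (γ A) ≫ φ.app (L.obj A) :=
          (Category.comp_id _).symm.trans (congrArg (L.map (φ.app A) ≫ ·) (hF A).symm)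
      _ = L.map (φ.app A ≫ γ A) ≫ φ.app (L.obj A) := by
          rw [L.map_comp, Category.assoc]
      _ = φ.app (L.obj A) := by
          rw [hT A]
          exact (congrArg (· ≫ φ.app (L.obj A)) (L.map_id _)).trans (Category.id_comp _)
  exact (congrArg (γ (L.obj A) ≫ ·) map_app_eq).trans (hJ (L.obj A))
end

section
/- For trivial self-adjunctions, alternatively, the first triangular equation is derivable from the remaining equations. Precisely: let S be a category, L : S ⥤ S an endofunctor, γ : 𝟭 S ⟶ L ⋙ L a natural transformation, and φ a family of morphisms φ_A : L.obj (L.obj A) ⟶ A, one for each object A (naturality of φ is NOT assumed). Assume for every object A: (φγG) γ.app (L.obj A) ≫ L.map (φ_A) = 𝟙 (L.obj A); (φγJ) γ.app A ≫ φ_A = 𝟙 A; and (γφ) φ_A ≫ γ.app A = 𝟙 (L.obj (L.obj A)). Then for every object A the triangular equation (φγF) holds: L.map (γ.app A) ≫ φ_{L.obj A} = 𝟙 (L.obj A). -/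
open CategoryTheory

/-- For trivial self-adjunctions, alternatively, the first triangular equation (φγF) is
derivable from the remaining equations: given a natural `γ : 𝟭 S ⟶ L ⋙ L` and a family
`φ_A : LLA ⟶ A` satisfying (φγG) `Lφ_A ∘ γ_{LA} = 𝟙_{LA}`, (φγJ) `φ_A ∘ γ_A = 𝟙_A`,
and (γφ) `γ_A ∘ φ_A = 𝟙_{LLA}`, one has (φγF) `φ_{LA} ∘ Lγ_A = 𝟙_{LA}`. -/
theorem trivial_self_adjunction_first_triangle {S : Type*} [Category S]
    (L : S ⥤ S) (γ : 𝟭 S ⟶ L ⋙ L) (φ : ∀ A : S, L.obj (L.obj A) ⟶ A)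
    (hG : ∀ A : S, γ.app (L.obj A) ≫ L.map (φ A) = 𝟙 (L.obj A))
    (hJ : ∀ A : S, γ.app A ≫ φ A = 𝟙 A)
    (hT : ∀ A : S, φ A ≫ γ.app A = 𝟙 (L.obj (L.obj A))) :
    ∀ A : S, L.map (γ.app A) ≫ φ (L.obj A) = 𝟙 (L.obj A) := by
  intro A
  have h : φ (L.obj A) = L.map (φ A) := by
    rw [← Category.comp_id (φ (L.obj A)), ← hG A]
    exact (Category.assoc _ _ _).symm.trans
      ((congrArg (· ≫ L.map (φ A)) (hT (L.obj A))).trans (Category.id_comp _))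
  rw [h]
  exact (L.map_comp _ _).symm.trans ((congrArg L.map (hJ A)).trans (L.map_id A))
end

section
/- A single triangular equation suffices to produce an n→-adjunction: the equation (n→ triang) delivers both triangular equations of the adjunction, one in A and one in Aᵒᵖ. Precisely: let A be a category, N : Aᵒᵖ ⥤ A a functor, and n→ : N.rightOp ⋙ N ⟶ 𝟭 A a natural transformation such that for every object A one has N.map ((n→.app A).op) ≫ n→.app (N.obj (op A)) = 𝟙 (N.obj (op A)) (i.e. n→_{¬A} ∘ ¬n→_A = 𝟙_{¬A}). Then there exists an adjunction adj : N ⊣ N.rightOp whose counit is n→ and whose unit has component at op A equal to (n→.app A).op. -/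
open CategoryTheory Opposite

/-- A single triangular equation suffices to produce an `n→`-adjunction: if the natural
transformation `n→ : N.rightOp ⋙ N ⟶ 𝟭 A` satisfies (n→ triang)
`n→_{¬A} ∘ ¬n→_A = 𝟙_{¬A}`, then there is an adjunction `N ⊣ N.rightOp` with counit `n→`
whose unit has components `(n→_A).op`. -/
theorem nTo_adjunction_from_single_triangle {A : Type*} [Category A]
    (N : Aᵒᵖ ⥤ A) (nTo : N.rightOp ⋙ N ⟶ 𝟭 A)
    (hTr : ∀ X : A,
      N.map ((nTo.app X).op) ≫ nTo.app (N.obj (op X)) = 𝟙 (N.obj (op X))) :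
    ∃ adj : N ⊣ N.rightOp, adj.counit = nTo ∧
      ∀ X : A, adj.unit.app (op X) = (nTo.app X).op := by
  refine ⟨{
    unit :=
      { app := fun X => (nTo.app X.unop).op
        naturality := fun X Y f => Quiver.Hom.unop_inj (nTo.naturality f.unop).symm }
    counit := nTo
    left_triangle_components := fun X => hTr X.unop
    right_triangle_components := fun Y => Quiver.Hom.unop_inj (hTr Y) }, rfl, fun _ => rfl⟩
end

section
/- A single triangular equation suffices to produce an n←-adjunction: the equation (n← triang) delivers both triangular equations of the adjunction, one in Aᵒᵖ and one in A. Precisely: let A be a category, N : Aᵒᵖ ⥤ A a functor, and n← : 𝟭 A ⟶ N.rightOp ⋙ N a natural transformation such that for every object A one has n←.app (N.obj (op A)) ≫ N.map ((n←.app A).op) = 𝟙 (N.obj (op A)) (i.e. ¬n←_A ∘ n←_{¬A} = 𝟙_{¬A}). Then there exists an adjunction adj : N.rightOp ⊣ N whose unit is n← and whose counit has component at op A equal to (n←.app A).op. -/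
open CategoryTheory Opposite

/-- A single triangular equation suffices to produce an `n←`-adjunction: if the natural
transformation `n← : 𝟭 A ⟶ N.rightOp ⋙ N` satisfies (n← triang)
`¬n←_A ∘ n←_{¬A} = 𝟙_{¬A}`, then there is an adjunction `N.rightOp ⊣ N` with unit `n←`
whose counit has components `(n←_A).op`. -/
theorem nFrom_adjunction_from_single_triangle {A : Type*} [Category A]
    (N : Aᵒᵖ ⥤ A) (nFrom : 𝟭 A ⟶ N.rightOp ⋙ N)
    (hTr : ∀ X : A,
      nFrom.app (N.obj (op X)) ≫ N.map ((nFrom.app X).op) = 𝟙 (N.obj (op X))) :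
    ∃ adj : N.rightOp ⊣ N, adj.unit = nFrom ∧
      ∀ X : A, adj.counit.app (op X) = (nFrom.app X).op := by
  refine ⟨{
    unit := nFrom
    counit :=
      { app := fun Y => (nFrom.app Y.unop).op
        naturality := fun _ _ f => Quiver.Hom.unop_inj (nFrom.naturality f.unop).symm }
    left_triangle_components := fun X => Quiver.Hom.unop_inj (hTr X)
    right_triangle_components := fun Y => hTr Y.unop }, rfl, fun _ => rfl⟩
end
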